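/- arXiv:2604.17384 — 3 statements merged into one kernel-verified Lean document; each statement's English description precedes it below -/
import Mathlib

section
/- Let K, m be positive integers, let A be a real K×K matrix, and let z⁽¹⁾, …, z⁽ᵐ⁾ be independent random vectors each uniformly distributed on {−1,+1}^K. Let f̂ = (1/m) Σ_{i=1}^m z⁽ⁱ⁾ ⊙ (A z⁽ⁱ⁾). Then for every coordinate k and every ε > 0, P(|f̂_k − A_{kk}| ≥ ε) ≤ ‖A‖_F² / (m ε²). Consequently, for every δ ∈ (0,1), taking m ≥ ‖A‖_F² / (δ ε²) samples guarantees P(|f̂_k − A_{kk}| ≥ ε) ≤ δ. -/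
open Finset

open scoped Classical in
/-- Probability of an event on a finite uniform probability space. -/
noncomputable def prob {Ω : Type*} [Fintype Ω] (p : Ω → Prop) : ℝ :=
  ((Finset.univ.filter p).card : ℝ) / (Fintype.card Ω : ℝ)

/-- The Rademacher sign vector (entries ±1) associated with a Boolean sample point. -/
def rsign {K : ℕ} (b : Fin K → Bool) : Fin K → ℝ := fun k => if b k then 1 else -1

/-- The Hutchinson-type estimator f̂ = (1/m) ∑ᵢ z⁽ⁱ⁾ ⊙ (A z⁽ⁱ⁾), where the i-th
Rademacher vector is z⁽ⁱ⁾ = rsign (ω i), evaluated at coordinate k. -/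
noncomputable def hutchinson {K m : ℕ} (A : Matrix (Fin K) (Fin K) ℝ)
    (ω : Fin m → Fin K → Bool) : Fin K → ℝ := fun k =>
  (1 / (m : ℝ)) * ∑ i : Fin m, rsign (ω i) k * ∑ j : Fin K, A k j * rsign (ω i) j

/-- Chebyshev's inequality on a finite uniform probability space. -/
theorem prob_le_abs_le {Ω : Type*} [Fintype Ω] (Y : Ω → ℝ) {ε : ℝ} (hε : 0 < ε) :
    prob (fun ω => ε ≤ |Y ω|) ≤ (∑ ω, Y ω ^ 2) / (Fintype.card Ω : ℝ) / ε ^ 2 := by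
  classical
  unfold prob
  rw [div_right_comm]
  gcongr
  rw [le_div_iff₀ (by positivity), ← nsmul_eq_mul]
  calc _ ≤ ∑ ω ∈ univ.filter (fun ω => ε ≤ |Y ω|), Y ω ^ 2 := by
        convert Finset.card_nsmul_le_sum _ _ (ε ^ 2) ?_
        intro ω hω
        rw [← sq_abs (Y ω)]
        gcongr
        simpa using hω
    _ ≤ ∑ ω, Y ω ^ 2 :=
        sum_le_sum_of_subset_of_nonneg (filter_subset _ _) fun _ _ _ => sq_nonneg _

/-- Parseval's identity for an orthogonal family of functions with unimodular values. -/
theorem sum_sq_sum_mul_of_orthogonal {Ω ι : Type*} [Fintype Ω] (s : Finset ι)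
    (c : ι → ℝ) (X : ι → Ω → ℝ) (hX : ∀ p ∈ s, ∀ ω, X p ω * X p ω = 1)
    (horth : ∀ p ∈ s, ∀ q ∈ s, p ≠ q → ∑ ω, X p ω * X q ω = 0) :
    ∑ ω, (∑ p ∈ s, c p * X p ω) ^ 2 = (Fintype.card Ω : ℝ) * ∑ p ∈ s, c p ^ 2 := by
  simp_rw [sq, sum_mul_sum]
  rw [sum_comm, mul_sum]
  refine sum_congr rfl fun p hp => ?_
  rw [sum_comm, sum_eq_single_of_mem p hp]
  · simp_rw [mul_mul_mul_comm, hX p hp]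
    simp
  · intro q hq hqp
    simp_rw [mul_mul_mul_comm]
    rw [← mul_sum, horth p hp q hq hqp.symm, mul_zero]

theorem rsign_mul_self {K : ℕ} (b : Fin K → Bool) (k : Fin K) : rsign b k * rsign b k = 1 := by
  unfold rsign
  split_ifs <;> norm_num

/-- The sample point with the sign of coordinate `j` of vector `i` reversed. -/
def flipSign {K m : ℕ} (i : Fin m) (j : Fin K) (ω : Fin m → Fin K → Bool) :
    Fin m → Fin K → Bool :=
  fun i' j' => if i' = i ∧ j' = j then !ω i' j' else ω i' j'

theorem flipSign_flipSign {K m : ℕ} (i : Fin m) (j : Fin K) (ω : Fin m → Fin K → Bool) :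
    flipSign i j (flipSign i j ω) = ω := by
  ext i' j'
  by_cases h : i' = i ∧ j' = j <;> simp [flipSign, h]

theorem rsign_flipSign_self {K m : ℕ} (i : Fin m) (j : Fin K) (ω : Fin m → Fin K → Bool) :
    rsign (flipSign i j ω i) j = -rsign (ω i) j := by
  cases h : ω i j <;> simp [rsign, flipSign, h]

theorem rsign_flipSign_of_ne {K m : ℕ} {i i' : Fin m} {j j' : Fin K}
    (h : ¬(i' = i ∧ j' = j)) (ω : Fin m → Fin K → Bool) :
    rsign (flipSign i j ω i') j' = rsign (ω i') j' := by
  simp only [rsign, flipSign, if_neg h]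

theorem sum_rsign_mul_rsign_eq_zero {K m : ℕ} {k : Fin K} {p q : Fin m × Fin K}
    (hp : p.2 ≠ k) (hpq : p ≠ q) :
    ∑ ω : Fin m → Fin K → Bool,
      (rsign (ω p.1) k * rsign (ω p.1) p.2) * (rsign (ω q.1) k * rsign (ω q.1) q.2) = 0 := by
  have hk (i : Fin m) (ω : Fin m → Fin K → Bool) :
      rsign (flipSign p.1 p.2 ω i) k = rsign (ω i) k :=
    rsign_flipSign_of_ne (fun h => hp h.2.symm) ω
  have hq : ¬(q.1 = p.1 ∧ q.2 = p.2) := fun h => hpq (Prod.ext h.1.symm h.2.symm)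
  have hflip (ω : Fin m → Fin K → Bool) :
      (rsign (flipSign p.1 p.2 ω p.1) k * rsign (flipSign p.1 p.2 ω p.1) p.2) *
        (rsign (flipSign p.1 p.2 ω q.1) k * rsign (flipSign p.1 p.2 ω q.1) q.2) =
      -((rsign (ω p.1) k * rsign (ω p.1) p.2) * (rsign (ω q.1) k * rsign (ω q.1) q.2)) := by
    rw [hk, hk, rsign_flipSign_self, rsign_flipSign_of_ne hq]
    ring
  rw [← self_eq_neg, ← sum_neg_distrib]
  simp_rw [← hflip]
  exact (Equiv.sum_comp
    (Function.Involutive.toPerm (flipSign p.1 p.2) (flipSign_flipSign p.1 p.2)) _).symm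

theorem hutchinson_sub_diag {K m : ℕ} (hm : 0 < m) (A : Matrix (Fin K) (Fin K) ℝ)
    (ω : Fin m → Fin K → Bool) (k : Fin K) :
    hutchinson A ω k - A k k = (1 / (m : ℝ)) *
      ∑ p ∈ univ ×ˢ univ.erase k, A k p.2 * (rsign (ω p.1) k * rsign (ω p.1) p.2) := by
  have hm' : (m : ℝ) ≠ 0 := by positivity
  have hi (i : Fin m) : rsign (ω i) k * ∑ j, A k j * rsign (ω i) j =
      A k k + ∑ j ∈ univ.erase k, A k j * (rsign (ω i) k * rsign (ω i) j) := by
    rw [← add_sum_erase _ _ (mem_univ k), mul_add, mul_left_comm, rsign_mul_self, mul_one, mul_sum]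
    exact congrArg _ (sum_congr rfl fun j _ => mul_left_comm _ _ _)
  rw [sum_product]
  simp only [hutchinson, hi, sum_add_distrib, sum_const, card_univ, Fintype.card_fin, nsmul_eq_mul]
  field_simp
  ring

/-- The mean squared error of the estimator, in closed form. -/
theorem sum_sq_hutchinson_sub_diag {K m : ℕ} (hm : 0 < m) (A : Matrix (Fin K) (Fin K) ℝ)
    (k : Fin K) :
    (∑ ω : Fin m → Fin K → Bool, (hutchinson A ω k - A k k) ^ 2) /
        (Fintype.card (Fin m → Fin K → Bool) : ℝ) =
      (∑ j ∈ univ.erase k, A k j ^ 2) / m := by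
  have hm' : (m : ℝ) ≠ 0 := by positivity
  have hc : (Fintype.card (Fin m → Fin K → Bool) : ℝ) ≠ 0 := by
    exact_mod_cast Fintype.card_ne_zero
  have parseval := sum_sq_sum_mul_of_orthogonal (univ ×ˢ univ.erase k)
    (fun p : Fin m × Fin K => A k p.2)
    (fun p (ω : Fin m → Fin K → Bool) => rsign (ω p.1) k * rsign (ω p.1) p.2)
    (fun p _ ω => by rw [mul_mul_mul_comm, rsign_mul_self, rsign_mul_self, one_mul])
    (fun p hp q _ hpq => sum_rsign_mul_rsign_eq_zero (by simpa using hp) hpq)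
  rw [sum_product (f := fun p : Fin m × Fin K => A k p.2 ^ 2)] at parseval
  simp only [sum_const, card_univ, Fintype.card_fin, nsmul_eq_mul] at parseval
  simp_rw [hutchinson_sub_diag hm, mul_pow]
  rw [← mul_sum, parseval]
  field_simp

theorem sum_erase_sq_le_frobenius {K : ℕ} (A : Matrix (Fin K) (Fin K) ℝ) (k : Fin K) :
    ∑ j ∈ univ.erase k, A k j ^ 2 ≤ ∑ i, ∑ j, A i j ^ 2 :=
  calc _ ≤ ∑ j, A k j ^ 2 :=
        sum_le_sum_of_subset_of_nonneg (erase_subset _ _) fun _ _ _ => sq_nonneg _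
    _ ≤ _ := single_le_sum (f := fun i => ∑ j, A i j ^ 2)
        (fun _ _ => sum_nonneg fun _ _ => sq_nonneg _) (mem_univ k)

/-- Chebyshev tail bound for the Hutchinson diagonal estimator with i.i.d. uniform
Rademacher vectors: P(|f̂ₖ − Aₖₖ| ≥ ε) ≤ ‖A‖_F² / (m ε²); consequently, if
m ≥ ‖A‖_F² / (δ ε²) then P(|f̂ₖ − Aₖₖ| ≥ ε) ≤ δ. The sample space
`Fin m → Fin K → Bool` with the uniform distribution encodes `m` independent
vectors, each uniform on `{−1,+1}^K`. -/
theorem stmt1 (K m : ℕ) (hK : 0 < K) (hm : 0 < m)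
    (A : Matrix (Fin K) (Fin K) ℝ) (k : Fin K) :
    (∀ ε : ℝ, 0 < ε →
      prob (fun ω : Fin m → Fin K → Bool => ε ≤ |hutchinson A ω k - A k k|)
        ≤ (∑ i : Fin K, ∑ j : Fin K, (A i j) ^ 2) / ((m : ℝ) * ε ^ 2)) ∧
    (∀ ε : ℝ, 0 < ε → ∀ δ : ℝ, 0 < δ → δ < 1 →
      (∑ i : Fin K, ∑ j : Fin K, (A i j) ^ 2) / (δ * ε ^ 2) ≤ (m : ℝ) →
      prob (fun ω : Fin m → Fin K → Bool => ε ≤ |hutchinson A ω k - A k k|) ≤ δ) := by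
  have tail (ε : ℝ) (hε : 0 < ε) :
      prob (fun ω : Fin m → Fin K → Bool => ε ≤ |hutchinson A ω k - A k k|)
        ≤ (∑ i : Fin K, ∑ j : Fin K, (A i j) ^ 2) / ((m : ℝ) * ε ^ 2) := by
    refine (prob_le_abs_le _ hε).trans ?_
    rw [sum_sq_hutchinson_sub_diag hm, div_div]
    gcongr
    exact sum_erase_sq_le_frobenius A k
  refine ⟨tail, fun ε hε δ hδ _ h => (tail ε hε).trans ?_⟩
  rw [div_le_iff₀ (by positivity)] at h ⊢
  linarith
end

section
/- Let ψ : ℝ^K → ℝ be differentiable and strictly convex, let θ_1, …, θ_m ∈ ℝ^K, and let α_1, …, α_m ≥ 0 with Σ_i α_i = 1. Define the Bregman divergence D_ψ(a ‖ b) = ψ(a) − ψ(b) − ⟨∇ψ(b), a − b⟩ and the barycenter objective J(θ) = Σ_{i=1}^m α_i D_ψ(θ ‖ θ_i). Then: (i) a point θ* ∈ ℝ^K is a global minimizer of J if and only if ∇ψ(θ*) = Σ_{i=1}^m α_i ∇ψ(θ_i); and (ii) J has at most one global minimizer. -/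
open scoped RealInnerProductSpace
open Finset

section Bregman

variable {F : Type*} [NormedAddCommGroup F] [InnerProductSpace ℝ F]

/-- First-order condition for convexity: the graph of a convex function lies above its tangent
hyperplanes. -/
theorem ConvexOn.add_inner_gradient_le [CompleteSpace F] {f : F → ℝ} {x : F}
    (hf : ConvexOn ℝ Set.univ f) (hx : DifferentiableAt ℝ f x) (y : F) :
    f x + ⟪gradient f x, y - x⟫ ≤ f y := by
  have hline : ConvexOn ℝ Set.univ (f ∘ AffineMap.lineMap (k := ℝ) x y) :=
    hf.comp_affineMap (AffineMap.lineMap x y)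
  have hderiv : HasDerivAt (f ∘ AffineMap.lineMap (k := ℝ) x y) (fderiv ℝ f x (y - x)) 0 := by
    refine HasFDerivAt.comp_hasDerivAt (0 : ℝ) ?_ AffineMap.hasDerivAt_lineMap
    simpa using hx.hasFDerivAt
  have hslope := hline.le_slope_of_hasDerivAt (Set.mem_univ 0) (Set.mem_univ 1) one_pos hderiv
  simp only [slope_def_field, Function.comp_apply, AffineMap.lineMap_apply_zero,
    AffineMap.lineMap_apply_one, sub_zero, div_one] at hslope
  rw [inner_gradient_left]
  linarith

/-- A differentiable convex function tilted by a linear functional is minimized exactly where its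
gradient represents that functional. -/
theorem ConvexOn.forall_sub_inner_le_iff_gradient_eq [CompleteSpace F] {f : F → ℝ} {x : F}
    (hf : ConvexOn ℝ Set.univ f) (hx : DifferentiableAt ℝ f x) (p : F) :
    (∀ y, f x - ⟪p, x⟫ ≤ f y - ⟪p, y⟫) ↔ gradient f x = p := by
  constructor
  · intro h
    have hmin : IsLocalMin (fun y => f y - ⟪p, y⟫) x := Filter.Eventually.of_forall h
    have hzero := hmin.hasFDerivAt_eq_zero
      (hx.hasFDerivAt.sub (innerSL ℝ p).hasFDerivAt)
    refine ext_inner_right ℝ fun v => ?_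
    rw [inner_gradient_left, sub_eq_zero.mp hzero, innerSL_apply_apply]
  · rintro rfl y
    have := hf.add_inner_gradient_le hx y
    rw [inner_sub_right] at this
    linarith

/-- A strictly convex function tilted by a linear functional has at most one minimizer. -/
theorem StrictConvexOn.eq_of_forall_sub_inner_le {f : F → ℝ} {p x y : F}
    (hf : StrictConvexOn ℝ Set.univ f)
    (hx : ∀ z, f x - ⟪p, x⟫ ≤ f z - ⟪p, z⟫) (hy : ∀ z, f y - ⟪p, y⟫ ≤ f z - ⟪p, z⟫) :
    x = y :=
  (hf.sub_concaveOn ((innerₛₗ ℝ p).concaveOn convex_univ)).eq_of_isMinOn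
    (fun z _ => hx z) (fun z _ => hy z) (Set.mem_univ x) (Set.mem_univ y)

/-- A convex combination of Bregman divergences is, up to an additive constant, the potential tilted
by the averaged gradient. -/
theorem sum_mul_bregman_eq {ι : Type*} [Fintype ι] (f : F → ℝ) (g : F → F) (w : ι → ℝ)
    (hw : ∑ i, w i = 1) (c : ι → F) (x : F) :
    ∑ i, w i * (f x - f (c i) - ⟪g (c i), x - c i⟫) =
      f x - ⟪∑ i, w i • g (c i), x⟫ + ∑ i, w i * (⟪g (c i), c i⟫ - f (c i)) := by
  have hfx : f x = ∑ i, w i * f x := by rw [← Finset.sum_mul, hw, one_mul]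
  rw [sum_inner]
  nth_rewrite 2 [hfx]
  rw [← Finset.sum_sub_distrib, ← Finset.sum_add_distrib]
  refine Finset.sum_congr rfl fun i _ => ?_
  rw [real_inner_smul_left, inner_sub_right]
  ring

end Bregman

/-- Bregman barycenter characterization (Section IV-G, compositional
correspondence): for a differentiable strictly convex potential ψ on ℝ^K, with
Bregman divergence D_ψ(a‖b) = ψ(a) − ψ(b) − ⟨∇ψ(b), a − b⟩ and barycenter
objective J(θ) = ∑ᵢ αᵢ D_ψ(θ‖θᵢ) for convex weights α, (i) θ* is a global
minimizer of J iff ∇ψ(θ*) = ∑ᵢ αᵢ ∇ψ(θᵢ), and (ii) J has at most one global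
minimizer. -/
theorem stmt10 (K m : ℕ) (ψ : EuclideanSpace ℝ (Fin K) → ℝ)
    (hdiff : Differentiable ℝ ψ)
    (hconv : StrictConvexOn ℝ Set.univ ψ)
    (θs : Fin m → EuclideanSpace ℝ (Fin K))
    (α : Fin m → ℝ) (hα : ∀ i, 0 ≤ α i) (hsum : ∑ i : Fin m, α i = 1) :
    let D : EuclideanSpace ℝ (Fin K) → EuclideanSpace ℝ (Fin K) → ℝ :=
      fun a b => ψ a - ψ b - ⟪gradient ψ b, a - b⟫
    let J : EuclideanSpace ℝ (Fin K) → ℝ := fun θ => ∑ i : Fin m, α i * D θ (θs i)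
    (∀ θstar : EuclideanSpace ℝ (Fin K),
      (∀ θ, J θstar ≤ J θ) ↔ gradient ψ θstar = ∑ i : Fin m, α i • gradient ψ (θs i)) ∧
    (∀ θ₁ θ₂ : EuclideanSpace ℝ (Fin K),
      (∀ θ, J θ₁ ≤ J θ) → (∀ θ, J θ₂ ≤ J θ) → θ₁ = θ₂) := by
  intro D J
  have hJ : ∀ a b, J a ≤ J b ↔
      ψ a - ⟪∑ i, α i • gradient ψ (θs i), a⟫ ≤ ψ b - ⟪∑ i, α i • gradient ψ (θs i), b⟫ := by
    intro a b
    simp only [J, D, sum_mul_bregman_eq ψ (gradient ψ) α hsum θs, add_le_add_iff_right]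
  simp only [hJ]
  exact ⟨fun θ => hconv.convexOn.forall_sub_inner_le_iff_gradient_eq (hdiff θ) _,
    fun _ _ => hconv.eq_of_forall_sub_inner_le⟩
end

section
/- Let H be a real symmetric positive semidefinite K×K matrix, F a real symmetric positive definite K×K matrix, and a, b ∈ ℝ^K. For λ > 0 let θ*(λ) = (H + λF)^{−1}(H a + λ F b) be the unique minimizer of the EWC objective (1/2)(θ−a)ᵀH(θ−a) + (λ/2)(θ−b)ᵀF(θ−b). Then λ · (θ*(λ) − b) = (F + H/λ)^{−1} H (a − b) for all λ > 0, and consequently λ · (θ*(λ) − b) → F^{−1} H (a − b) as λ → ∞. In particular, ‖θ*(λ) − b‖ = O(1/λ): the displacement from the old-task optimum (the forgetting) decays at rate 1/λ in the regularization strength. -/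
open Matrix Filter Asymptotics

/-- The displacement of the minimizer from `b`, rescaled by the regularization strength. -/
theorem smul_inv_mulVec_sub {n : Type*} [Fintype n] [DecidableEq n] {H F : Matrix n n ℝ}
    {c : ℝ} (hc : c ≠ 0) (hdet : IsUnit (H + c • F).det) (a b : n → ℝ) :
    c • ((H + c • F)⁻¹ *ᵥ (H *ᵥ a + c • (F *ᵥ b)) - b) =
      (F + c⁻¹ • H)⁻¹ *ᵥ (H *ᵥ (a - b)) := by
  have hdisp : (H + c • F)⁻¹ *ᵥ (H *ᵥ a + c • (F *ᵥ b)) - b =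
      (H + c • F)⁻¹ *ᵥ (H *ᵥ (a - b)) := by
    have hb : (H + c • F)⁻¹ *ᵥ ((H + c • F) *ᵥ b) = b := by
      rw [mulVec_mulVec, nonsing_inv_mul _ hdet, one_mulVec]
    nth_rw 2 [← hb]
    rw [← mulVec_sub, add_mulVec, smul_mulVec, mulVec_sub H]
    congr 1
    abel
  have hfactor : F + c⁻¹ • H = c⁻¹ • (H + c • F) := by
    rw [smul_add, inv_smul_smul₀ hc, add_comm]
  have hinv : (F + c⁻¹ • H)⁻¹ = c • (H + c • F)⁻¹ := by
    refine inv_eq_right_inv ?_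
    rw [hfactor, smul_mul_smul_comm, inv_mul_cancel₀ hc, one_smul, mul_nonsing_inv _ hdet]
  rw [hdisp, hinv, smul_mulVec]

/-- Matrix inversion is continuous along the path `F + c⁻¹ • H` as `c → ∞`. -/
theorem tendsto_inv_add_inv_smul {n : Type*} [Fintype n] [DecidableEq n] (H : Matrix n n ℝ)
    {F : Matrix n n ℝ} (hF : IsUnit F.det) :
    Tendsto (fun c : ℝ => (F + c⁻¹ • H)⁻¹) atTop (nhds F⁻¹) := by
  have hpath : Tendsto (fun c : ℝ => F + c⁻¹ • H) atTop (nhds F) := by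
    simpa using tendsto_const_nhds.add ((tendsto_inv_atTop_zero (𝕜 := ℝ)).smul_const H)
  refine (continuousAt_matrix_inv F ?_).tendsto.comp hpath
  rw [Ring.inverse_eq_inv']
  exact continuousAt_inv₀ hF.ne_zero

/-- 1/λ forgetting rate of EWC (Section IV-C): with θ*(λ) = (H+λF)⁻¹(Ha+λFb)
the unique EWC minimizer, one has λ·(θ*(λ) − b) = (F + H/λ)⁻¹ H (a − b) for all
λ > 0, hence λ·(θ*(λ) − b) → F⁻¹H(a − b) as λ → ∞, and in particular
‖θ*(λ) − b‖ = O(1/λ): the displacement from the old-task optimum decays at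
rate 1/λ. -/
theorem stmt13 (K : ℕ) (H F : Matrix (Fin K) (Fin K) ℝ)
    (hH : H.PosSemidef) (hF : F.PosDef) (a b : Fin K → ℝ) :
    let θstar : ℝ → (Fin K → ℝ) := fun lam =>
      (H + lam • F)⁻¹ *ᵥ (H *ᵥ a + lam • (F *ᵥ b))
    (∀ lam : ℝ, 0 < lam →
      lam • (θstar lam - b) = (F + lam⁻¹ • H)⁻¹ *ᵥ (H *ᵥ (a - b))) ∧
    Tendsto (fun lam : ℝ => lam • (θstar lam - b)) atTop
      (nhds (F⁻¹ *ᵥ (H *ᵥ (a - b)))) ∧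
    (fun lam : ℝ => θstar lam - b) =O[atTop] (fun lam : ℝ => 1 / lam) := by
  intro θstar
  have hid : ∀ lam : ℝ, 0 < lam →
      lam • (θstar lam - b) = (F + lam⁻¹ • H)⁻¹ *ᵥ (H *ᵥ (a - b)) := fun lam hlam =>
    smul_inv_mulVec_sub hlam.ne'
      (PosDef.posSemidef_add hH (hF.smul hlam)).det_pos.ne'.isUnit a b
  have hlim : Tendsto (fun lam : ℝ => lam • (θstar lam - b)) atTop
      (nhds (F⁻¹ *ᵥ (H *ᵥ (a - b)))) := by
    have hcont : Continuous fun A : Matrix (Fin K) (Fin K) ℝ => A *ᵥ (H *ᵥ (a - b)) :=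
      continuous_id.matrix_mulVec continuous_const
    refine ((hcont.tendsto _).comp
      (tendsto_inv_add_inv_smul H hF.det_pos.ne'.isUnit)).congr' ?_
    filter_upwards [eventually_gt_atTop 0] with lam hlam
    exact (hid lam hlam).symm
  refine ⟨hid, hlim, ?_⟩
  have hO := (isBigO_refl (fun lam : ℝ => 1 / lam) atTop).smul (hlim.isBigO_one ℝ)
  refine hO.congr' ?_ (by simp)
  filter_upwards [eventually_gt_atTop 0] with lam hlam
  rw [one_div, inv_smul_smul₀ hlam.ne']
end
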